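/- arXiv:2506.22351 — 2 statements merged into one kernel-verified Lean document; each statement's English description precedes it below -/
import Mathlib

section
/- Let A : ℝ → Matrix (Fin 3) (Fin 3) ℝ be differentiable with A t orthogonal for every t, let γ, γ̃ : ℝ → ℝ³ be differentiable, set b t := γ t - A t *ᵥ γ̃ t, and suppose the no-skid condition deriv γ t = A t *ᵥ (deriv γ̃ t) holds for every t. Then for every t and every y ∈ ℝ³, Q t *ᵥ y + (deriv b t - Q t *ᵥ b t) = Q t *ᵥ (y - γ t), where Q t = (deriv A t) * (A t)ᵀ. In other words, the instantaneous motion of the family f_t(x) = A t *ᵥ x + b t vanishes at the contact point γ(t), so γ(t) is a center of the instantaneous rotation. -/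
open Matrix

/-- Product rule for the action of a matrix-valued curve on a vector-valued curve. -/
theorem hasDerivAt_mulVec {m n : Type*} [Fintype m] [Fintype n]
    {A : ℝ → Matrix m n ℝ} {A' : Matrix m n ℝ} {v : ℝ → n → ℝ} {v' : n → ℝ} {t : ℝ}
    (hA : ∀ i j, HasDerivAt (fun s => A s i j) (A' i j) t) (hv : HasDerivAt v v' t) :
    HasDerivAt (fun s => A s *ᵥ v s) (A' *ᵥ v t + A t *ᵥ v') t := by
  rw [hasDerivAt_pi] at hv ⊢
  intro i
  simp only [Matrix.mulVec, dotProduct, Pi.add_apply, ← Finset.sum_add_distrib]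
  exact HasDerivAt.fun_sum fun j _ => (hA i j).mul (hv j)

/-- Rolling without skidding: with `b t = γ t - A t *ᵥ Γ t` (here `Γ` plays the role of the
curve `γ̃` on the rolling surface) and the no-skid condition `deriv γ t = A t *ᵥ deriv Γ t`,
the instantaneous motion `y ↦ Q t *ᵥ y + (b' t - Q t *ᵥ b t)` equals `y ↦ Q t *ᵥ (y - γ t)`;
in particular it vanishes at the contact point `γ t`. -/
theorem instantaneousMotion_centered_at_contact
    (A : ℝ → Matrix (Fin 3) (Fin 3) ℝ) (γ Γ : ℝ → Fin 3 → ℝ)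
    (hA : ∀ i j, Differentiable ℝ fun t => A t i j)
    (hγ : Differentiable ℝ γ) (hΓ : Differentiable ℝ Γ)
    (horth : ∀ t : ℝ, A t * (A t)ᵀ = 1)
    (hskid : ∀ t : ℝ, deriv γ t = A t *ᵥ deriv Γ t)
    (t : ℝ) (y : Fin 3 → ℝ) :
    ((Matrix.of fun i j => deriv (fun s => A s i j) t) * (A t)ᵀ) *ᵥ y
        + (deriv (fun s => γ s - A s *ᵥ Γ s) t
            - ((Matrix.of fun i j => deriv (fun s => A s i j) t) * (A t)ᵀ) *ᵥ
                (γ t - A t *ᵥ Γ t))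
      = ((Matrix.of fun i j => deriv (fun s => A s i j) t) * (A t)ᵀ) *ᵥ (y - γ t) := by
  set A' : Matrix (Fin 3) (Fin 3) ℝ := Matrix.of fun i j => deriv (fun s => A s i j) t
  have hderiv : deriv (fun s => γ s - A s *ᵥ Γ s) t = -(A' *ᵥ Γ t) := by
    have hAΓ := hasDerivAt_mulVec (A' := A') (fun i j => (hA i j t).hasDerivAt) (hΓ t).hasDerivAt
    rw [((hγ t).hasDerivAt.fun_sub hAΓ).deriv, hskid t]
    abel
  have hcancel : (A' * (A t)ᵀ) *ᵥ (A t *ᵥ Γ t) = A' *ᵥ Γ t := by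
    rw [Matrix.mulVec_mulVec, Matrix.mul_assoc, mul_eq_one_comm.mp (horth t), Matrix.mul_one]
  rw [hderiv, Matrix.mulVec_sub, Matrix.mulVec_sub, hcancel]
  abel
end

section
/- Algebraic core of the main theorem (first direction): let κ₁, κ₂, r ∈ ℝ with r ≠ 0, define ℓ(θ) := (1 - r*(κ₁*cos θ^2 + κ₂*sin θ^2))^2 + r^2*((κ₂ - κ₁)*sin θ*cos θ)^2, and let θ₁, θ₂, θ₃ ∈ ℝ be pairwise nonparallel (θᵢ - θⱼ is not an integer multiple of π for i ≠ j). If ℓ(θ₁) = ℓ(θ₂) and ℓ(θ₂) = ℓ(θ₃), then κ₁ = κ₂ or r*(κ₁ + κ₂) = 2. -/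
open Real

/-- Euler-type form of the squared speed: a combination of `cos² θ` and `sin² θ`. -/
theorem squared_speed_eq (κ₁ κ₂ r θ : ℝ) :
    (1 - r * (κ₁ * cos θ ^ 2 + κ₂ * sin θ ^ 2)) ^ 2 + r ^ 2 * ((κ₂ - κ₁) * sin θ * cos θ) ^ 2
      = (1 - r * κ₁) ^ 2 + r * (κ₁ - κ₂) * (2 - r * (κ₁ + κ₂)) * sin θ ^ 2 := by
  rw [mul_pow _ (cos θ), cos_sq']
  ring

theorem sin_sq_sub_sin_sq (a b : ℝ) : sin a ^ 2 - sin b ^ 2 = sin (a + b) * sin (a - b) := by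
  rw [sin_add, sin_sub]
  linear_combination sin b ^ 2 * sin_sq_add_cos_sq a - sin a ^ 2 * sin_sq_add_cos_sq b

/-- Nonparallel directions with equal `sin²` are mirror images in the principal directions. -/
theorem exists_add_eq_int_mul_pi_of_sin_sq_eq {a b : ℝ} (hab : ¬∃ k : ℤ, a - b = k * π)
    (h : sin a ^ 2 = sin b ^ 2) : ∃ k : ℤ, a + b = k * π := by
  have hprod : sin (a + b) * sin (a - b) = 0 := by rw [← sin_sq_sub_sin_sq, h, sub_self]
  rcases mul_eq_zero.mp hprod with hs | hs
  · exact (sin_eq_zero_iff.mp hs).imp fun _ hk => hk.symm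
  · exact absurd ((sin_eq_zero_iff.mp hs).imp fun _ hk => hk.symm) hab

/-- Algebraic core of the main theorem (first direction): if the squared speed
`ℓ(θ) = (1 - r κ_n(θ))² + r² τ_g(θ)²` is the same for three pairwise nonparallel
directions, then the point is umbilic (`κ₁ = κ₂`) or `r (κ₁ + κ₂) = 2`. -/
theorem umbilic_or_mean_curvature_of_three_equal_speeds
    (κ₁ κ₂ r : ℝ) (hr : r ≠ 0) (θ₁ θ₂ θ₃ : ℝ)
    (h₁₂ : ¬∃ k : ℤ, θ₁ - θ₂ = k * π)
    (h₁₃ : ¬∃ k : ℤ, θ₁ - θ₃ = k * π)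
    (h₂₃ : ¬∃ k : ℤ, θ₂ - θ₃ = k * π)
    (e₁ :
      (fun θ : ℝ => (1 - r * (κ₁ * cos θ ^ 2 + κ₂ * sin θ ^ 2)) ^ 2
          + r ^ 2 * ((κ₂ - κ₁) * sin θ * cos θ) ^ 2) θ₁
        = (fun θ : ℝ => (1 - r * (κ₁ * cos θ ^ 2 + κ₂ * sin θ ^ 2)) ^ 2
          + r ^ 2 * ((κ₂ - κ₁) * sin θ * cos θ) ^ 2) θ₂)
    (e₂ :
      (fun θ : ℝ => (1 - r * (κ₁ * cos θ ^ 2 + κ₂ * sin θ ^ 2)) ^ 2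
          + r ^ 2 * ((κ₂ - κ₁) * sin θ * cos θ) ^ 2) θ₂
        = (fun θ : ℝ => (1 - r * (κ₁ * cos θ ^ 2 + κ₂ * sin θ ^ 2)) ^ 2
          + r ^ 2 * ((κ₂ - κ₁) * sin θ * cos θ) ^ 2) θ₃) :
    κ₁ = κ₂ ∨ r * (κ₁ + κ₂) = 2 := by
  simp only [squared_speed_eq] at e₁ e₂
  by_contra! hne
  have hc : r * (κ₁ - κ₂) * (2 - r * (κ₁ + κ₂)) ≠ 0 :=
    mul_ne_zero (mul_ne_zero hr (sub_ne_zero.mpr hne.1)) (sub_ne_zero.mpr hne.2.symm)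
  have s₁₂ := mul_left_cancel₀ hc (add_left_cancel e₁)
  have s₂₃ := mul_left_cancel₀ hc (add_left_cancel e₂)
  obtain ⟨m, hm⟩ := exists_add_eq_int_mul_pi_of_sin_sq_eq h₁₂ s₁₂
  obtain ⟨n, hn⟩ := exists_add_eq_int_mul_pi_of_sin_sq_eq h₁₃ (s₁₂.trans s₂₃)
  refine h₂₃ ⟨m - n, ?_⟩
  push_cast
  linear_combination hm - hn
end
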